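/- arXiv:2301.00211 — 4 statements merged into one kernel-verified Lean document; each statement's English description precedes it below -/
import Mathlib

section
/- For every real r ≥ 1 and all vectors a, b ∈ ℝ³, one has ⟨|a|^{r-1} a - |b|^{r-1} b, a - b⟩ ≥ (1/2)|a|^{r-1}|a-b|² + (1/2)|b|^{r-1}|a-b|², where |·| denotes the Euclidean norm on ℝ³ and ⟨·,·⟩ the Euclidean inner product. -/
open scoped RealInnerProductSpace

/-- Radial vector fields `v ↦ φ(|v|) v` with nondecreasing `φ` are monotone, with a quantitative
lower bound. -/
theorem half_add_mul_norm_sub_sq_le_inner_smul_sub_smul {E : Type*} [NormedAddCommGroup E]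
    [InnerProductSpace ℝ E] {φ : ℝ → ℝ} (hφ : MonotoneOn φ (Set.Ici 0)) (a b : E) :
    (φ ‖a‖ + φ ‖b‖) / 2 * ‖a - b‖ ^ 2 ≤ ⟪φ ‖a‖ • a - φ ‖b‖ • b, a - b⟫ := by
  have hmono : 0 ≤ (φ ‖a‖ - φ ‖b‖) * (‖a‖ ^ 2 - ‖b‖ ^ 2) := by
    rcases le_total ‖a‖ ‖b‖ with h | h
    · exact mul_nonneg_of_nonpos_of_nonpos
        (sub_nonpos.2 (hφ (norm_nonneg a) (norm_nonneg b) h)) (sub_nonpos.2 (by gcongr))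
    · exact mul_nonneg
        (sub_nonneg.2 (hφ (norm_nonneg b) (norm_nonneg a) h)) (sub_nonneg.2 (by gcongr))
  rw [norm_sub_sq_real]
  simp only [inner_sub_left, inner_sub_right, real_inner_smul_left, real_inner_self_eq_norm_sq,
    real_inner_comm a b]
  linarith

/-- Pointwise monotonicity inequality for the damping nonlinearity `C(v) = |v|^{r-1} v`:
for `r ≥ 1` and `a, b ∈ ℝ³`,
`⟨|a|^{r-1} a - |b|^{r-1} b, a - b⟩ ≥ ½|a|^{r-1}|a-b|² + ½|b|^{r-1}|a-b|²`. -/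
theorem stmt0 (r : ℝ) (hr : 1 ≤ r) (a b : EuclideanSpace ℝ (Fin 3)) :
    (1 / 2) * ‖a‖ ^ (r - 1) * ‖a - b‖ ^ 2 + (1 / 2) * ‖b‖ ^ (r - 1) * ‖a - b‖ ^ 2 ≤
      ⟪‖a‖ ^ (r - 1) • a - ‖b‖ ^ (r - 1) • b, a - b⟫ := by
  have key := half_add_mul_norm_sub_sq_le_inner_smul_sub_smul
    (Real.monotoneOn_rpow_Ici_of_exponent_nonneg (sub_nonneg.2 hr)) a b
  linarith
end

section
/- Let r ≥ 3 be a real number and u ∈ C_c^∞(ℝ³; ℝ³). Then ∫_{ℝ³} ⟨−Δu(x), |u(x)|^{r-1} u(x)⟩ dx = ∫_{ℝ³} |∇u(x)|² |u(x)|^{r-1} dx + (4(r−1)/(r+1)²) ∫_{ℝ³} |∇(|u|^{(r+1)/2})(x)|² dx, where |∇u|² := ∑_{i,j=1}^{3} (∂uⱼ/∂xᵢ)², |u|^{(r+1)/2} denotes the real-valued function x ↦ |u(x)|^{(r+1)/2} (which is continuously differentiable since (r+1)/2 ≥ 2), and Δ is the componentwise Laplacian. -/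
open MeasureTheory

noncomputable section

/-- ℝ³ as a Euclidean space. -/
abbrev E3 : Type := EuclideanSpace ℝ (Fin 3)

/-- Partial derivative `∂g/∂xᵢ` of a scalar function on ℝ³. -/
def pd (i : Fin 3) (g : E3 → ℝ) (x : E3) : ℝ :=
  fderiv ℝ g x (EuclideanSpace.single i 1)

/-- The Laplacian of a scalar function on ℝ³. -/
def lap (g : E3 → ℝ) (x : E3) : ℝ :=
  ∑ i : Fin 3, pd i (fun y => pd i g y) x

lemma ContDiff.pd {n m : WithTop ℕ∞} {g : E3 → ℝ} (hg : ContDiff ℝ n g) (hmn : m + 1 ≤ n)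
    (i : Fin 3) : ContDiff ℝ m (pd i g) :=
  (hg.fderiv_right hmn).clm_apply contDiff_const

lemma HasCompactSupport.pd {g : E3 → ℝ} (hg : HasCompactSupport g) (i : Fin 3) :
    HasCompactSupport (pd i g) :=
  hg.fderiv_apply ℝ _

lemma pd_coord (i k : Fin 3) {u : E3 → E3} {x : E3} (hu : DifferentiableAt ℝ u x) :
    pd i (fun y => u y k) x = (fderiv ℝ u x (EuclideanSpace.single i 1)) k := by
  have h : HasFDerivAt (fun y => u y k)
      ((EuclideanSpace.proj k : E3 →L[ℝ] ℝ).comp (fderiv ℝ u x)) x :=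
    (EuclideanSpace.proj k : E3 →L[ℝ] ℝ).hasFDerivAt.comp x hu.hasFDerivAt
  rw [pd, h.fderiv]
  rfl

lemma pd_mul (i : Fin 3) {f g : E3 → ℝ} {x : E3} (hf : DifferentiableAt ℝ f x)
    (hg : DifferentiableAt ℝ g x) :
    pd i (fun y => f y * g y) x = f x * pd i g x + g x * pd i f x := by
  simp [pd, fderiv_fun_mul hf hg]

lemma pd_norm_rpow (i : Fin 3) {u : E3 → E3} {x : E3} (hu : DifferentiableAt ℝ u x) {p : ℝ}
    (hp : 1 < p) :
    pd i (fun y => ‖u y‖ ^ p) x =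
      p * ‖u x‖ ^ (p - 2) * ∑ k : Fin 3, u x k * pd i (fun y => u y k) x := by
  have h := (hasFDerivAt_norm_rpow (u x) hp).comp x hu.hasFDerivAt
  have h' : pd i (fun y => ‖u y‖ ^ p) x =
      p * ‖u x‖ ^ (p - 2) * inner ℝ (u x) (fderiv ℝ u x (EuclideanSpace.single i 1)) := by
    rw [pd, show (fun y => ‖u y‖ ^ p) = (fun z : E3 => ‖z‖ ^ p) ∘ u from rfl, h.fderiv]
    simp
  simp_rw [h', pd_coord i _ hu, PiLp.inner_apply, RCLike.inner_apply, conj_trivial, mul_comm]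

/-- Integration by parts for partial derivatives of compactly supported `C¹` functions. -/
lemma integral_pd_mul (i : Fin 3) {f g : E3 → ℝ} (hf : ContDiff ℝ 1 f) (hg : ContDiff ℝ 1 g)
    (hfc : HasCompactSupport f) :
    ∫ x, -(pd i f x) * g x = ∫ x, f x * pd i g x := by
  have cf : Continuous (pd i f) := (hf.pd (m := 0) (by norm_num) i).continuous
  have cg : Continuous (pd i g) := (hg.pd (m := 0) (by norm_num) i).continuous
  have h := integral_mul_fderiv_eq_neg_fderiv_mul_of_integrable (μ := (volume : Measure E3))
    (f := f) (g := g) (v := EuclideanSpace.single i 1)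
    ((cf.mul hg.continuous).integrable_of_hasCompactSupport (hfc.pd i).mul_right)
    ((hf.continuous.mul cg).integrable_of_hasCompactSupport hfc.mul_right)
    ((hf.continuous.mul hg.continuous).integrable_of_hasCompactSupport hfc.mul_right)
    (fun x _ => hf.differentiable one_ne_zero x) (fun x _ => hg.differentiable one_ne_zero x)
  simp_rw [neg_mul, integral_neg]
  exact h.symm

/-- The pointwise form of the identity obtained after integrating by parts. -/
lemma sum_pd_mul_pd_damping {r : ℝ} (hr : 3 ≤ r) {u : E3 → E3} {x : E3}
    (hu : DifferentiableAt ℝ u x) :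
    ∑ j : Fin 3, ∑ i : Fin 3,
        pd i (fun y => u y j) x * pd i (fun y => ‖u y‖ ^ (r - 1) * u y j) x =
      (∑ i : Fin 3, ∑ j : Fin 3, (pd i (fun y => u y j) x) ^ 2) * ‖u x‖ ^ (r - 1) +
        (4 * (r - 1) / (r + 1) ^ 2) *
          ∑ i : Fin 3, (pd i (fun y => ‖u y‖ ^ ((r + 1) / 2)) x) ^ 2 := by
  have hn : DifferentiableAt ℝ (fun y => ‖u y‖ ^ (r - 1)) x :=
    ((hasFDerivAt_norm_rpow (u x) (by linarith : 1 < r - 1)).comp x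
      hu.hasFDerivAt).differentiableAt
  have hc (j : Fin 3) : DifferentiableAt ℝ (fun y => u y j) x :=
    (EuclideanSpace.proj j : E3 →L[ℝ] ℝ).differentiableAt.comp x hu
  have hpow : (‖u x‖ ^ ((r + 1) / 2 - 2)) ^ 2 = ‖u x‖ ^ (r - 1 - 2) := by
    rw [← Real.rpow_natCast, ← Real.rpow_mul (norm_nonneg _)]
    congr 1
    push_cast
    ring
  have hr1 : r + 1 ≠ 0 := by linarith
  simp_rw [fun i j => pd_mul i hn (hc j), pd_norm_rpow _ hu (by linarith : 1 < r - 1),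
    pd_norm_rpow _ hu (by linarith : 1 < (r + 1) / 2), mul_pow, hpow]
  rw [Finset.sum_comm, Finset.sum_mul, Finset.mul_sum, ← Finset.sum_add_distrib]
  refine Finset.sum_congr rfl fun i _ => ?_
  simp only [Fin.sum_univ_three]
  field_simp
  ring

/-- Integration-by-parts identity for the damping nonlinearity: for real `r ≥ 3`
and `u ∈ C_c^∞(ℝ³;ℝ³)`,
`∫ ⟨−Δu, |u|^{r−1}u⟩ dx = ∫ |∇u|²|u|^{r−1} dx + (4(r−1)/(r+1)²) ∫ |∇(|u|^{(r+1)/2})|² dx`. -/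
theorem stmt6 (r : ℝ) (hr : 3 ≤ r) (u : E3 → E3)
    (hu : ContDiff ℝ (⊤ : ℕ∞) u) (huc : HasCompactSupport u) :
    (∫ x : E3, ∑ j : Fin 3, (-(lap (fun y => u y j) x)) * (‖u x‖ ^ (r - 1) * u x j)) =
      (∫ x : E3, (∑ i : Fin 3, ∑ j : Fin 3, (pd i (fun y => u y j) x) ^ 2) * ‖u x‖ ^ (r - 1))
        + (4 * (r - 1) / (r + 1) ^ 2) *
          ∫ x : E3, ∑ i : Fin 3, (pd i (fun y => ‖u y‖ ^ ((r + 1) / 2)) x) ^ 2 := by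
  have hu1 : ContDiff ℝ 1 u := hu.of_le (by exact_mod_cast le_top)
  have hv (j : Fin 3) : ContDiff ℝ 2 (fun y => u y j) :=
    ((EuclideanSpace.proj j : E3 →L[ℝ] ℝ).contDiff.comp hu).of_le
      (WithTop.coe_le_coe.2 (le_top : (2 : ℕ∞) ≤ ⊤))
  have hvc (j : Fin 3) : HasCompactSupport (fun y => u y j) :=
    huc.comp_left (g := fun z : E3 => z j) rfl
  have hp (i j : Fin 3) : ContDiff ℝ 1 (pd i (fun y => u y j)) :=
    (hv j).pd (by norm_num) i
  have hpc (i j : Fin 3) : HasCompactSupport (pd i (fun y => u y j)) := (hvc j).pd i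
  have hN {p : ℝ} (h : 1 < p) : ContDiff ℝ 1 (fun y => ‖u y‖ ^ p) := hu1.norm_rpow h
  have hw : ContDiff ℝ 1 (fun y => ‖u y‖ ^ (r - 1)) := hN (by linarith)
  have hg (j : Fin 3) : ContDiff ℝ 1 (fun y => ‖u y‖ ^ (r - 1) * u y j) :=
    hw.mul ((hv j).of_le (by norm_num))
  have hq : ContDiff ℝ 1 (fun y => ‖u y‖ ^ ((r + 1) / 2)) := hN (by linarith)
  have hqc : HasCompactSupport (fun y => ‖u y‖ ^ ((r + 1) / 2)) :=
    huc.comp_left (g := fun z : E3 => ‖z‖ ^ ((r + 1) / 2)) (by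
      simp [Real.zero_rpow (by linarith : (r + 1) / 2 ≠ 0)])
  have cont {f : E3 → ℝ} (hf : ContDiff ℝ 1 f) (i : Fin 3) : Continuous (pd i f) :=
    (hf.pd (m := 0) (by norm_num) i).continuous
  have int_left (i j : Fin 3) : Integrable
      (fun x => -(pd i (pd i (fun y => u y j)) x) * (‖u x‖ ^ (r - 1) * u x j)) :=
    ((cont (hp i j) i).neg.mul (hg j).continuous).integrable_of_hasCompactSupport
      ((hpc i j).pd i).neg.mul_right
  have int_right (i j : Fin 3) : Integrable
      (fun x => pd i (fun y => u y j) x * pd i (fun y => ‖u y‖ ^ (r - 1) * u y j) x) :=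
    ((hp i j).continuous.mul (cont (hg j) i)).integrable_of_hasCompactSupport (hpc i j).mul_right
  have int_grad : Integrable
      (fun x => (∑ i : Fin 3, ∑ j : Fin 3, (pd i (fun y => u y j) x) ^ 2) * ‖u x‖ ^ (r - 1)) := by
    simp_rw [Finset.sum_mul, sq, mul_assoc]
    exact integrable_finsetSum _ fun i _ => integrable_finsetSum _ fun j _ =>
      ((hp i j).continuous.mul ((hp i j).continuous.mul
        hw.continuous)).integrable_of_hasCompactSupport (hpc i j).mul_right
  have int_norm : Integrable
      (fun x => ∑ i : Fin 3, (pd i (fun y => ‖u y‖ ^ ((r + 1) / 2)) x) ^ 2) := by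
    simp_rw [sq]
    exact integrable_finsetSum _ fun i _ =>
      ((cont hq i).mul (cont hq i)).integrable_of_hasCompactSupport (hqc.pd i).mul_right
  rw [← integral_const_mul, ← integral_add int_grad (int_norm.const_mul _)]
  simp_rw [← sum_pd_mul_pd_damping hr (hu1.differentiable one_ne_zero _), lap,
    ← Finset.sum_neg_distrib, Finset.sum_mul]
  rw [integral_finsetSum _ fun j _ => integrable_finsetSum _ fun i _ => int_left i j,
    integral_finsetSum _ fun j _ => integrable_finsetSum _ fun i _ => int_right i j]
  refine Finset.sum_congr rfl fun j _ => ?_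
  rw [integral_finsetSum _ fun i _ => int_left i j, integral_finsetSum _ fun i _ => int_right i j]
  exact Finset.sum_congr rfl fun i _ => integral_pd_mul i (hp i j) (hg j) (hpc i j)

end
end

section
/- Let σ > 1, N > 0, and for a continuous function ω : ℝ → ℝ with |ω(t)| ≤ N e^{|t|} for all t define z(ω)(t) := ω(t) − σ ∫_{−∞}^{t} e^{−σ(t−ξ)} ω(ξ) dξ (the integral converges absolutely). Suppose ω_k, ω_0 : ℝ → ℝ (k ∈ ℕ) are continuous, satisfy ω_k(0) = ω_0(0) = 0 and |ω_k(t)| ≤ N e^{|t|}, |ω_0(t)| ≤ N e^{|t|} for all t, and ω_k → ω_0 uniformly on every compact interval of ℝ. Then for every τ ∈ ℝ, T > 0 and a ∈ ℝ: sup_{t ∈ [τ, τ+T]} ( |z(ω_k)(t) − z(ω_0)(t)| + |e^{a·z(ω_k)(t)} − e^{a·z(ω_0)(t)}| ) → 0 as k → ∞. -/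
open MeasureTheory Filter

noncomputable section

/-- The pathwise Ornstein–Uhlenbeck functional
`z(ω)(t) = ω(t) − σ ∫_{−∞}^t e^{−σ(t−ξ)} ω(ξ) dξ`. -/
def ouZ (σ : ℝ) (ω : ℝ → ℝ) (t : ℝ) : ℝ :=
  ω t - σ * ∫ ξ in Set.Iic t, Real.exp (-σ * (t - ξ)) * ω ξ

/-- On `(-∞, b]`, a path of growth at most `N e^{|ξ|}` weighted by `e^{σξ}` is dominated by a
multiple of `e^{(σ-1)ξ}`. -/
lemma abs_exp_mul_le_of_growth {σ N b ξ : ℝ} {f : ℝ → ℝ} (hN : 0 ≤ N)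
    (hf : ∀ t, |f t| ≤ N * Real.exp |t|) (hξ : ξ ≤ b) :
    |Real.exp (σ * ξ) * f ξ| ≤ N * Real.exp (2 * |b|) * Real.exp ((σ - 1) * ξ) := by
  have habs : |ξ| ≤ 2 * |b| - ξ := by
    rcases abs_cases ξ with h | h <;> linarith [le_abs_self b, abs_nonneg b]
  calc |Real.exp (σ * ξ) * f ξ| = Real.exp (σ * ξ) * |f ξ| := by
        rw [abs_mul, Real.abs_exp]
    _ ≤ Real.exp (σ * ξ) * (N * Real.exp (2 * |b| - ξ)) := by
        gcongr
        exact (hf ξ).trans (by gcongr)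
    _ = N * Real.exp (2 * |b|) * Real.exp ((σ - 1) * ξ) := by
        rw [mul_left_comm, mul_assoc, ← Real.exp_add, ← Real.exp_add]
        ring_nf

lemma integrableOn_exp_mul_of_growth {σ N : ℝ} {f : ℝ → ℝ} (hσ : 1 < σ) (hN : 0 ≤ N)
    (hfc : Continuous f) (hf : ∀ t, |f t| ≤ N * Real.exp |t|) (b : ℝ) :
    IntegrableOn (fun ξ => Real.exp (σ * ξ) * f ξ) (Set.Iic b) := by
  refine Integrable.mono' ((integrableOn_exp_mul_Iic (sub_pos.2 hσ) b).const_mul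
    (N * Real.exp (2 * |b|))) (by fun_prop) ?_
  filter_upwards [ae_restrict_mem measurableSet_Iic] with ξ hξ
  exact abs_exp_mul_le_of_growth hN hf hξ

lemma ouZ_eq (σ : ℝ) (f : ℝ → ℝ) (t : ℝ) :
    ouZ σ f t = f t - σ * Real.exp (-σ * t) * ∫ ξ in Set.Iic t, Real.exp (σ * ξ) * f ξ := by
  have h (ξ : ℝ) : Real.exp (-σ * (t - ξ)) * f ξ =
      Real.exp (-σ * t) * (Real.exp (σ * ξ) * f ξ) := by
    rw [← mul_assoc, ← Real.exp_add]
    ring_nf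
  simp only [ouZ, h, integral_const_mul, mul_assoc]

lemma ouZ_sub {σ N : ℝ} {f g : ℝ → ℝ} (hσ : 1 < σ) (hN : 0 ≤ N)
    (hfc : Continuous f) (hf : ∀ t, |f t| ≤ N * Real.exp |t|)
    (hgc : Continuous g) (hg : ∀ t, |g t| ≤ N * Real.exp |t|) (t : ℝ) :
    ouZ σ f t - ouZ σ g t = ouZ σ (fun s => f s - g s) t := by
  simp only [ouZ_eq, mul_sub (Real.exp _)]
  rw [integral_sub (integrableOn_exp_mul_of_growth hσ hN hfc hf t)
    (integrableOn_exp_mul_of_growth hσ hN hgc hg t)]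
  ring

/-- On `[τ, b]` the functional is controlled by the path and one weighted integral up to `b`. -/
lemma abs_ouZ_le {σ N τ b t : ℝ} {f : ℝ → ℝ} (hσ : 1 < σ) (hN : 0 ≤ N)
    (hfc : Continuous f) (hf : ∀ t, |f t| ≤ N * Real.exp |t|) (ht : t ∈ Set.Icc τ b) :
    |ouZ σ f t| ≤ |f t| +
      σ * Real.exp (-σ * τ) * ∫ ξ in Set.Iic b, |Real.exp (σ * ξ) * f ξ| := by
  have hint : |∫ ξ in Set.Iic t, Real.exp (σ * ξ) * f ξ| ≤
      ∫ ξ in Set.Iic b, |Real.exp (σ * ξ) * f ξ| :=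
    abs_integral_le_integral_abs.trans <|
      setIntegral_mono_set (integrableOn_exp_mul_of_growth hσ hN hfc hf b).abs
        (Eventually.of_forall fun _ => abs_nonneg _)
        (Set.Iic_subset_Iic.2 ht.2).eventuallyLE
  have hexp : Real.exp (-σ * t) ≤ Real.exp (-σ * τ) :=
    Real.exp_le_exp.2 (mul_le_mul_of_nonpos_left ht.1 (by linarith))
  rw [ouZ_eq]
  refine (abs_sub _ _).trans ?_
  rw [abs_mul, abs_of_pos (mul_pos (by linarith) (Real.exp_pos _) : 0 < σ * Real.exp (-σ * t))]
  gcongr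

/-- Dominated convergence for the weighted integrals. -/
lemma tendsto_integral_abs_exp_mul_sub {σ N : ℝ} {ω : ℕ → ℝ → ℝ} {ω₀ : ℝ → ℝ} (hσ : 1 < σ)
    (hN : 0 ≤ N) (hωc : ∀ k, Continuous (ω k)) (hω₀c : Continuous ω₀)
    (hωb : ∀ k t, |ω k t| ≤ N * Real.exp |t|) (hω₀b : ∀ t, |ω₀ t| ≤ N * Real.exp |t|)
    (hlim : ∀ t, Tendsto (fun k => ω k t) atTop (nhds (ω₀ t))) (b : ℝ) :
    Tendsto (fun k => ∫ ξ in Set.Iic b, |Real.exp (σ * ξ) * (ω k ξ - ω₀ ξ)|) atTop (nhds 0) := by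
  have key := tendsto_integral_of_dominated_convergence (μ := volume.restrict (Set.Iic b))
    (F := fun k ξ => |Real.exp (σ * ξ) * (ω k ξ - ω₀ ξ)|) (f := fun _ => 0)
    (fun ξ => 2 * N * Real.exp (2 * |b|) * Real.exp ((σ - 1) * ξ))
    (fun k => by have := hωc k; fun_prop)
    ((integrableOn_exp_mul_Iic (sub_pos.2 hσ) b).const_mul _)
    (fun k => by
      filter_upwards [ae_restrict_mem measurableSet_Iic] with ξ hξ
      rw [Real.norm_eq_abs, abs_abs]
      exact abs_exp_mul_le_of_growth (f := fun s => ω k s - ω₀ s) (by positivity)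
        (fun s => (abs_sub _ _).trans (by linarith [hωb k s, hω₀b s])) hξ)
    (Eventually.of_forall fun ξ => by
      simpa using (((hlim ξ).sub_const (ω₀ ξ)).const_mul (Real.exp (σ * ξ))).abs)
  simpa using key

/-- Locally uniform convergence of the paths gives locally uniform convergence of `ouZ`. -/
lemma tendstoUniformlyOn_ouZ {σ N : ℝ} {ω : ℕ → ℝ → ℝ} {ω₀ : ℝ → ℝ} (hσ : 1 < σ)
    (hN : 0 ≤ N) (hωc : ∀ k, Continuous (ω k)) (hω₀c : Continuous ω₀)
    (hωb : ∀ k t, |ω k t| ≤ N * Real.exp |t|) (hω₀b : ∀ t, |ω₀ t| ≤ N * Real.exp |t|)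
    (hconv : ∀ K : Set ℝ, IsCompact K → TendstoUniformlyOn (fun k => ω k) ω₀ atTop K) (τ b : ℝ) :
    TendstoUniformlyOn (fun k => ouZ σ (ω k)) (ouZ σ ω₀) atTop (Set.Icc τ b) := by
  have hlim : ∀ t, Tendsto (fun k => ω k t) atTop (nhds (ω₀ t)) := fun t =>
    (hconv {t} isCompact_singleton).tendsto_at rfl
  have hI := (tendsto_integral_abs_exp_mul_sub hσ hN hωc hω₀c hωb hω₀b hlim b).const_mul
    (σ * Real.exp (-σ * τ))
  rw [mul_zero] at hI
  rw [Metric.tendstoUniformlyOn_iff]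
  intro ε hε
  filter_upwards [hI.eventually_lt_const (half_pos hε),
    Metric.tendstoUniformlyOn_iff.1 (hconv _ isCompact_Icc) (ε / 2) (half_pos hε)]
    with k hk hu t ht
  have hut := hu t ht
  rw [dist_comm, Real.dist_eq] at hut ⊢
  rw [ouZ_sub hσ hN (hωc k) (hωb k) hω₀c hω₀b]
  have := abs_ouZ_le (N := 2 * N) (f := fun s => ω k s - ω₀ s) hσ (by positivity)
    ((hωc k).sub hω₀c) (fun s => (abs_sub _ _).trans (by linarith [hωb k s, hω₀b s])) ht
  linarith

lemma exists_abs_ouZ_le {σ N : ℝ} {f : ℝ → ℝ} (hσ : 1 < σ) (hN : 0 ≤ N)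
    (hfc : Continuous f) (hf : ∀ t, |f t| ≤ N * Real.exp |t|) (τ b : ℝ) :
    ∃ M, ∀ t ∈ Set.Icc τ b, |ouZ σ f t| ≤ M := by
  obtain ⟨C, hC⟩ := isCompact_Icc.exists_bound_of_continuousOn (s := Set.Icc τ b) hfc.continuousOn
  exact ⟨_, fun t ht => (abs_ouZ_le hσ hN hfc hf ht).trans (add_le_add_left (hC t ht) _)⟩

/-- Convergence statement (2.7) of Lemma 2.3: if sample paths `ω_k ∈ Ω_N` converge to
`ω₀ ∈ Ω_N` in the compact-open topology, then
`sup_{t∈[τ,τ+T]} (|z(ω_k)(t) − z(ω₀)(t)| + |e^{a z(ω_k)(t)} − e^{a z(ω₀)(t)}|) → 0`. -/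
theorem stmt10 (σ N : ℝ) (hσ : 1 < σ) (hN : 0 < N)
    (ω : ℕ → ℝ → ℝ) (ω₀ : ℝ → ℝ)
    (hωc : ∀ k, Continuous (ω k)) (hω₀c : Continuous ω₀)
    (hω0 : ∀ k, ω k 0 = 0) (hω₀0 : ω₀ 0 = 0)
    (hωb : ∀ k t, |ω k t| ≤ N * Real.exp |t|) (hω₀b : ∀ t, |ω₀ t| ≤ N * Real.exp |t|)
    (hconv : ∀ K : Set ℝ, IsCompact K → TendstoUniformlyOn (fun k => ω k) ω₀ atTop K) :
    ∀ (τ T a : ℝ), 0 < T → ∀ ε : ℝ, 0 < ε → ∃ K : ℕ, ∀ k ≥ K,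
      ∀ t ∈ Set.Icc τ (τ + T),
        |ouZ σ (ω k) t - ouZ σ ω₀ t| +
          |Real.exp (a * ouZ σ (ω k) t) - Real.exp (a * ouZ σ ω₀ t)| < ε := by
  intro τ T a _ ε hε
  obtain ⟨M, hM⟩ := exists_abs_ouZ_le hσ hN.le hω₀c hω₀b τ (τ + T)
  have hcont : Continuous fun u : ℝ => |u| + Real.exp (|a| * M) * |Real.exp (a * u) - 1| := by
    fun_prop
  obtain ⟨δ, hδ, hsmall⟩ := Metric.continuousAt_iff.1 (hcont.continuousAt (x := 0)) ε hε
  obtain ⟨K, hK⟩ := eventually_atTop.1 (Metric.tendstoUniformlyOn_iff.1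
    (tendstoUniformlyOn_ouZ hσ hN.le hωc hω₀c hωb hω₀b hconv τ (τ + T)) δ hδ)
  refine ⟨K, fun k hk t ht => ?_⟩
  set x := ouZ σ (ω k) t
  set y := ouZ σ ω₀ t
  have hxy : dist (x - y) 0 < δ := by
    rw [dist_zero_right, ← dist_eq_norm, dist_comm]
    exact hK k hk t ht
  have hlt : |x - y| + Real.exp (|a| * M) * |Real.exp (a * (x - y)) - 1| < ε := by
    have h := hsmall hxy
    simp only [Real.dist_eq, abs_zero, mul_zero, Real.exp_zero, sub_self, add_zero, sub_zero] at h
    exact (le_abs_self _).trans_lt h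
  have hfactor : Real.exp (a * x) - Real.exp (a * y) =
      Real.exp (a * y) * (Real.exp (a * (x - y)) - 1) := by
    rw [mul_sub, ← Real.exp_add, mul_one]
    ring_nf
  have hy : a * y ≤ |a| * M :=
    (le_abs_self _).trans ((abs_mul a y).le.trans
      (mul_le_mul_of_nonneg_left (hM t ht) (abs_nonneg a)))
  rw [hfactor, abs_mul, Real.abs_exp]
  refine lt_of_le_of_lt ?_ hlt
  gcongr

end
end

section
/- Let f : ℝ × ℝ³ → ℝ³ be measurable with ∫_{ℝ³} |f(t,x)|² dx < ∞ for a.e. t and with t ↦ ∫_{ℝ³} |f(t,x)|² dx locally integrable on ℝ, and let f_∞ ∈ L²(ℝ³; ℝ³). Assume that ∫_{−∞}^{τ} ∫_{ℝ³} |f(t,x) − f_∞(x)|² dx dt → 0 as τ → −∞. Then for every κ > 0 and every τ ∈ ℝ: lim_{k→∞} sup_{s ≤ τ} ∫_{−∞}^{s} e^{κ(ξ−s)} ∫_{{x ∈ ℝ³ : |x| ≥ k}} |f(ξ,x)|² dx dξ = 0. -/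
open MeasureTheory Filter
open scoped ENNReal NNReal

noncomputable section

theorem tendsto_setLIntegral_norm_ge {E : Type*} [NormedAddCommGroup E] [MeasurableSpace E]
    [OpensMeasurableSpace E] {μ : Measure E} {g : E → ℝ≥0∞} (hg : ∫⁻ x, g x ∂μ ≠ ⊤) :
    Tendsto (fun k : ℕ => ∫⁻ x in {x : E | (k : ℝ) ≤ ‖x‖}, g x ∂μ) atTop (nhds 0) := by
  have hms (k : ℕ) : MeasurableSet {x : E | (k : ℝ) ≤ ‖x‖} :=
    measurableSet_le measurable_const measurable_norm
  suffices h : Tendsto (fun k : ℕ => μ.withDensity g {x : E | (k : ℝ) ≤ ‖x‖}) atTop (nhds 0) from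
    h.congr fun k => withDensity_apply g (hms k)
  have hempty : ⋂ k : ℕ, {x : E | (k : ℝ) ≤ ‖x‖} = ∅ := by
    ext x
    obtain ⟨k, hk⟩ := exists_nat_gt ‖x‖
    simpa using ⟨k, hk⟩
  rw [← measure_empty (μ := μ.withDensity g), ← hempty]
  refine tendsto_measure_iInter_atTop (fun k => (hms k).nullMeasurableSet)
    (fun k l hkl x (hx : (l : ℝ) ≤ ‖x‖) =>
      show (k : ℝ) ≤ ‖x‖ from (Nat.cast_le.2 hkl).trans hx) ⟨0, ?_⟩
  refine ne_top_of_le_ne_top ?_ (measure_mono (Set.subset_univ _))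
  rwa [withDensity_apply _ MeasurableSet.univ, setLIntegral_univ]

theorem nnnorm_sq_le_two_mul_add {E : Type*} [NormedAddCommGroup E] {a b c : E}
    (h : ‖a‖ ≤ ‖b‖ + ‖c‖) :
    (‖a‖₊ : ℝ≥0∞) ^ 2 ≤ 2 * (‖b‖₊ : ℝ≥0∞) ^ 2 + 2 * (‖c‖₊ : ℝ≥0∞) ^ 2 := by
  have : ‖a‖₊ ^ 2 ≤ 2 * ‖b‖₊ ^ 2 + 2 * ‖c‖₊ ^ 2 := by
    rw [← NNReal.coe_le_coe]
    push_cast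
    nlinarith [sq_nonneg (‖b‖ - ‖c‖), norm_nonneg a, norm_nonneg b, norm_nonneg c]
  exact_mod_cast this

theorem lintegral_nnnorm_sq_le_two_mul_add {α E : Type*} [MeasurableSpace α]
    [NormedAddCommGroup E] [MeasurableSpace E] [OpensMeasurableSpace E] {μ : Measure α}
    {a b c : α → E} (hc : Measurable c) (h : ∀ x, ‖a x‖ ≤ ‖b x‖ + ‖c x‖) :
    ∫⁻ x, (‖a x‖₊ : ℝ≥0∞) ^ 2 ∂μ ≤
      2 * (∫⁻ x, (‖b x‖₊ : ℝ≥0∞) ^ 2 ∂μ) + 2 * ∫⁻ x, (‖c x‖₊ : ℝ≥0∞) ^ 2 ∂μ := by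
  rw [← lintegral_const_mul' _ _ ENNReal.ofNat_ne_top,
    ← lintegral_const_mul' _ _ ENNReal.ofNat_ne_top, ← lintegral_add_right _ (by fun_prop)]
  exact lintegral_mono fun x => nnnorm_sq_le_two_mul_add (h x)

theorem setLIntegral_Iic_exp_mul_sub {κ : ℝ} (hκ : 0 < κ) (s : ℝ) :
    ∫⁻ ξ in Set.Iic s, ENNReal.ofReal (Real.exp (κ * (ξ - s))) = ENNReal.ofReal κ⁻¹ := by
  have hexp (ξ : ℝ) : Real.exp (κ * (ξ - s)) = Real.exp (-(κ * s)) * Real.exp (κ * ξ) := by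
    rw [← Real.exp_add]
    ring_nf
  simp_rw [hexp]
  rw [← ofReal_integral_eq_lintegral_ofReal ((integrableOn_exp_mul_Iic hκ s).const_mul _)
    (ae_of_all _ fun ξ => by positivity), integral_const_mul, integral_exp_mul_Iic hκ,
    mul_div_assoc', ← Real.exp_add]
  simp

/-- If the squared `L²` distance from `f t` to `finf` is integrable near `-∞`, then it is
integrable on every half-line `Iic τ`. -/
theorem setLIntegral_Iic_sub_sq_ne_top {f : ℝ → E3 → E3} {finf : E3 → E3}
    (hfinfm : Measurable finf)
    (hloc : ∀ a b : ℝ, (∫⁻ t in Set.Icc a b, ∫⁻ x : E3, (‖f t x‖₊ : ℝ≥0∞) ^ 2) < ⊤)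
    (hfinfL2 : (∫⁻ x : E3, (‖finf x‖₊ : ℝ≥0∞) ^ 2) < ⊤)
    (hconv : Tendsto (fun τ : ℝ => ∫⁻ t in Set.Iic τ, ∫⁻ x : E3,
        (‖f t x - finf x‖₊ : ℝ≥0∞) ^ 2) atBot (nhds 0)) (τ : ℝ) :
    ∫⁻ t in Set.Iic τ, ∫⁻ x : E3, (‖f t x - finf x‖₊ : ℝ≥0∞) ^ 2 ≠ ⊤ := by
  obtain ⟨a, ha⟩ := (hconv.eventually (gt_mem_nhds ENNReal.zero_lt_top)).exists
  have hIcc : ∫⁻ t in Set.Icc a τ, ∫⁻ x : E3, (‖f t x - finf x‖₊ : ℝ≥0∞) ^ 2 < ⊤ := by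
    refine (lintegral_mono fun t =>
      lintegral_nnnorm_sq_le_two_mul_add hfinfm fun x => norm_sub_le (f t x) (finf x)).trans_lt ?_
    rw [lintegral_add_right _ measurable_const, lintegral_const_mul' _ _ ENNReal.ofNat_ne_top,
      setLIntegral_const, Real.volume_Icc]
    exact ENNReal.add_lt_top.2 ⟨ENNReal.mul_lt_top ENNReal.ofNat_lt_top (hloc a τ),
      ENNReal.mul_lt_top (ENNReal.mul_lt_top ENNReal.ofNat_lt_top hfinfL2) ENNReal.ofReal_lt_top⟩
  refine ((lintegral_mono_set ?_).trans
    (lintegral_union_le _ (Set.Iic a) (Set.Icc a τ))).trans_lt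
      (ENNReal.add_lt_top.2 ⟨ha, hIcc⟩) |>.ne
  exact fun t ht => (le_total t a).imp id fun h => ⟨h, ht⟩

/-- Remark 1.3(ii), uniform tails-smallness (1.7): if the non-autonomous forcing `f`
converges backward to `finf ∈ L²(ℝ³)` in the sense
`∫_{−∞}^{τ} ‖f(t) − finf‖²_{L²} dt → 0` as `τ → −∞`, then for every `κ > 0`, `τ ∈ ℝ`,
`lim_{k→∞} sup_{s ≤ τ} ∫_{−∞}^{s} e^{κ(ξ−s)} ∫_{|x| ≥ k} |f(ξ,x)|² dx dξ = 0`. -/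
theorem stmt13 (f : ℝ → E3 → E3) (finf : E3 → E3)
    (hfm : Measurable (Function.uncurry f)) (hfinfm : Measurable finf)
    (hfL2 : ∀ᵐ t : ℝ, (∫⁻ x : E3, (‖f t x‖₊ : ℝ≥0∞) ^ 2) < ⊤)
    (hloc : ∀ a b : ℝ, (∫⁻ t in Set.Icc a b, ∫⁻ x : E3, (‖f t x‖₊ : ℝ≥0∞) ^ 2) < ⊤)
    (hfinfL2 : (∫⁻ x : E3, (‖finf x‖₊ : ℝ≥0∞) ^ 2) < ⊤)
    (hconv : Tendsto (fun τ : ℝ => ∫⁻ t in Set.Iic τ, ∫⁻ x : E3,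
        (‖f t x - finf x‖₊ : ℝ≥0∞) ^ 2) atBot (nhds 0)) :
    ∀ κ : ℝ, 0 < κ → ∀ τ : ℝ,
      Tendsto (fun k : ℕ =>
          ⨆ s ∈ Set.Iic τ, ∫⁻ ξ in Set.Iic s,
            ENNReal.ofReal (Real.exp (κ * (ξ - s))) *
              ∫⁻ x in {x : E3 | (k : ℝ) ≤ ‖x‖}, (‖f ξ x‖₊ : ℝ≥0∞) ^ 2)
        atTop (nhds 0) := by
  intro κ hκ τ
  have hDm : Measurable (Function.uncurry fun (t : ℝ) (x : E3) =>
      (‖f t x - finf x‖₊ : ℝ≥0∞) ^ 2) := by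
    have : Measurable fun p : ℝ × E3 => f p.1 p.2 := hfm
    simp only [Function.uncurry_def]
    fun_prop
  have hG : ∫⁻ x : E3, ∫⁻ t in Set.Iic τ, (‖f t x - finf x‖₊ : ℝ≥0∞) ^ 2 ≠ ⊤ := by
    rw [← lintegral_lintegral_swap hDm.aemeasurable]
    exact setLIntegral_Iic_sub_sq_ne_top hfinfm hloc hfinfL2 hconv τ
  have hlim := (ENNReal.Tendsto.const_mul (a := 2) (tendsto_setLIntegral_norm_ge hG)
    (Or.inr ENNReal.ofNat_ne_top)).add (ENNReal.Tendsto.const_mul (a := ENNReal.ofReal κ⁻¹ * 2)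
      (tendsto_setLIntegral_norm_ge hfinfL2.ne)
      (Or.inr (ENNReal.mul_ne_top ENNReal.ofReal_ne_top ENNReal.ofNat_ne_top)))
  simp only [mul_zero, add_zero] at hlim
  refine tendsto_of_tendsto_of_tendsto_of_le_of_le tendsto_const_nhds hlim
    (fun _ => zero_le) fun k => iSup₂_le fun s hs => ?_
  set B : Set E3 := {x : E3 | (k : ℝ) ≤ ‖x‖}
  have hpt (ξ : ℝ) : ∫⁻ x in B, (‖f ξ x‖₊ : ℝ≥0∞) ^ 2 ≤
      2 * (∫⁻ x in B, (‖f ξ x - finf x‖₊ : ℝ≥0∞) ^ 2) +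
        2 * ∫⁻ x in B, (‖finf x‖₊ : ℝ≥0∞) ^ 2 :=
    lintegral_nnnorm_sq_le_two_mul_add hfinfm fun x => by
      simpa using norm_add_le (f ξ x - finf x) (finf x)
  calc ∫⁻ ξ in Set.Iic s, ENNReal.ofReal (Real.exp (κ * (ξ - s))) *
        ∫⁻ x in B, (‖f ξ x‖₊ : ℝ≥0∞) ^ 2
      ≤ ∫⁻ ξ in Set.Iic s, (2 * (∫⁻ x in B, (‖f ξ x - finf x‖₊ : ℝ≥0∞) ^ 2) +
          ENNReal.ofReal (Real.exp (κ * (ξ - s))) *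
            (2 * ∫⁻ x in B, (‖finf x‖₊ : ℝ≥0∞) ^ 2)) := by
        refine setLIntegral_mono' measurableSet_Iic fun ξ hξ => ?_
        refine (mul_le_mul_right (hpt ξ) _).trans ?_
        rw [mul_add]
        refine add_le_add (mul_le_of_le_one_left' ?_) le_rfl
        rw [ENNReal.ofReal_le_one, Real.exp_le_one_iff]
        exact mul_nonpos_of_nonneg_of_nonpos hκ.le (sub_nonpos.2 hξ)
    _ = 2 * (∫⁻ ξ in Set.Iic s, ∫⁻ x in B, (‖f ξ x - finf x‖₊ : ℝ≥0∞) ^ 2) +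
          ENNReal.ofReal κ⁻¹ * 2 * ∫⁻ x in B, (‖finf x‖₊ : ℝ≥0∞) ^ 2 := by
        rw [lintegral_add_right _ (by fun_prop), lintegral_const_mul' _ _ ENNReal.ofNat_ne_top,
          lintegral_mul_const _ (by fun_prop), setLIntegral_Iic_exp_mul_sub hκ, mul_assoc]
    _ ≤ _ := by
        rw [← lintegral_lintegral_swap hDm.aemeasurable]
        gcongr
        exact hs

end
end
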